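/- arXiv:2106.02696 — 4 statements merged into one kernel-verified Lean document; each statement's English description precedes it below -/
import Mathlib

section
/- For all permutations x and y of {1,…,n}, the permutation deviation distance satisfies D_dev(x, y) ≤ ⌊n²/2⌋, and this bound is attained: D_dev between the identity permutation and its reversal i ↦ n+1−i equals ⌊n²/2⌋. -/
/-- The permutation deviation distance: D_dev(x,y) = Σ_i |i − pos(x(i), y)|,
where pos(v, y) = y⁻¹(v). -/
def Ddev {n : ℕ} (x y : Equiv.Perm (Fin n)) : ℤ :=
  ∑ i : Fin n, |((i : ℕ) : ℤ) - ((y.symm (x i) : ℕ) : ℤ)|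

theorem sum_abs_aux : ∀ n : ℕ,
    ∑ i ∈ Finset.range n, |2 * (i : ℤ) - ((n : ℤ) - 1)| = ((n ^ 2 / 2 : ℕ) : ℤ)
  | 0 => by simp
  | 1 => by simp
  | n + 2 => by
    have ih := sum_abs_aux n
    have h2 : (n + 2) ^ 2 / 2 = n ^ 2 / 2 + (2 * n + 2) := by
      have : (n + 2) ^ 2 = n ^ 2 + 2 * (2 * n + 2) := by ring
      omega
    rw [Finset.sum_range_succ, Finset.sum_range_succ', h2]
    have h3 : ∑ i ∈ Finset.range n, |2 * ((i + 1 : ℕ) : ℤ) - (((n + 2 : ℕ) : ℤ) - 1)|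
        = ∑ i ∈ Finset.range n, |2 * (i : ℤ) - ((n : ℤ) - 1)| := by
      apply Finset.sum_congr rfl
      intro i _
      congr 1
      push_cast
      ring
    rw [h3, ih]
    have h4 : |2 * ((0 : ℕ) : ℤ) - (((n + 2 : ℕ) : ℤ) - 1)| = n + 1 := by
      rw [abs_of_nonpos] <;> push_cast <;> linarith
    have h5 : |2 * ((n + 1 : ℕ) : ℤ) - (((n + 2 : ℕ) : ℤ) - 1)| = n + 1 := by
      rw [abs_of_nonneg] <;> push_cast <;> linarith
    rw [h4, h5, Nat.cast_add]
    push_cast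
    ring

theorem sum_abs_fin (n : ℕ) :
    ∑ i : Fin n, |2 * ((i : ℕ) : ℤ) - ((n : ℤ) - 1)| = ((n ^ 2 / 2 : ℕ) : ℤ) := by
  rw [← sum_abs_aux n, Finset.sum_range]

/-- D_dev is bounded above by ⌊n²/2⌋, and the bound is attained between the identity
permutation and its reversal. -/
theorem Ddev_le_and_attained (n : ℕ) :
    (∀ x y : Equiv.Perm (Fin n), Ddev x y ≤ ((n ^ 2 / 2 : ℕ) : ℤ)) ∧
      Ddev (1 : Equiv.Perm (Fin n)) Fin.revPerm = ((n ^ 2 / 2 : ℕ) : ℤ) := by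
  constructor
  · intro x y
    have hS := sum_abs_fin n
    have hP : ∑ i : Fin n, |2 * ((y.symm (x i) : ℕ) : ℤ) - ((n : ℤ) - 1)|
        = ((n ^ 2 / 2 : ℕ) : ℤ) := by
      rw [← hS]
      exact Equiv.sum_comp (x.trans y.symm)
        (fun i : Fin n => |2 * ((i : ℕ) : ℤ) - ((n : ℤ) - 1)|)
    have hle : 2 * Ddev x y ≤ ∑ i : Fin n, (|2 * ((i : ℕ) : ℤ) - ((n : ℤ) - 1)|
        + |2 * ((y.symm (x i) : ℕ) : ℤ) - ((n : ℤ) - 1)|) := by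
      unfold Ddev
      rw [Finset.mul_sum]
      apply Finset.sum_le_sum
      intro i _
      generalize (((y.symm (x i) : Fin n) : ℕ) : ℤ) = b
      generalize ((i : ℕ) : ℤ) = a
      grind
    rw [Finset.sum_add_distrib, hS, hP] at hle
    linarith
  · rw [← sum_abs_fin n]
    unfold Ddev
    apply Finset.sum_congr rfl
    intro i _
    have hi := i.isLt
    simp only [Fin.revPerm_symm, Equiv.Perm.coe_one, id_eq, Fin.revPerm_apply, Fin.val_rev]
    congr 1
    omega
end

section
/- Let M = (m_{ij}) be an n×n real matrix, σ a permutation of {1,…,n}, and 1 ≤ i < j ≤ n. Let τ be the permutation obtained from σ by the forward insert move of the element at position i to position j, i.e. τ(k) = σ(k) for k < i or k > j, τ(k) = σ(k+1) for i ≤ k < j, and τ(j) = σ(i). Then the change in the LOP objective is f(τ) − f(σ) = Σ_{k=i+1}^{j} (m_{σ(k)σ(i)} − m_{σ(i)σ(k)}). -/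
/-- Delta of a forward insert move: if τ is obtained from σ by moving the element at
position i to position j > i (shifting the intermediate elements one place back), then
f(τ) − f(σ) = Σ_{k=i+1}^{j} (m_{σ(k)σ(i)} − m_{σ(i)σ(k)}). -/
theorem lop_forward_insert_delta (n : ℕ) (M : Matrix (Fin n) (Fin n) ℝ)
    (σ τ : Equiv.Perm (Fin n)) (i j : Fin n) (hij : i < j)
    (houtside : ∀ k : Fin n, k < i ∨ j < k → τ k = σ k)
    (hshift : ∀ (k : Fin n) (hk : (k : ℕ) + 1 < n), i ≤ k → k < j → τ k = σ ⟨(k : ℕ) + 1, hk⟩)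
    (hlast : τ j = σ i) :
    (∑ a : Fin n, ∑ b : Fin n, if a < b then M (τ a) (τ b) else 0) -
      (∑ a : Fin n, ∑ b : Fin n, if a < b then M (σ a) (σ b) else 0) =
    ∑ k ∈ Finset.Ioc i j, (M (σ k) (σ i) - M (σ i) (σ k)) := by
  -- `p k` is the position in `τ` of the element at position `k` of `σ`
  set p : Equiv.Perm (Fin n) := σ.trans τ.symm with hp
  have hpτ : ∀ a, τ (p a) = σ a := fun a => by simp [hp]
  have hpi : p i = j := by
    apply τ.injective; rw [hpτ, hlast]
  have hpout : ∀ k, k < i ∨ j < k → p k = k := fun k hk => by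
    apply τ.injective; rw [hpτ, houtside k hk]
  have hpmid : ∀ k, i < k → k ≤ j → (p k : ℕ) + 1 = k := fun k h1 h2 => by
    have hk : (k : ℕ) - 1 + 1 = k := by
      have : (i : ℕ) < k := h1
      omega
    have hlt : (k : ℕ) - 1 < n := by omega
    have : p k = ⟨(k : ℕ) - 1, hlt⟩ := by
      apply τ.injective
      rw [hpτ, hshift ⟨(k : ℕ) - 1, hlt⟩ (by simp only [hk]; exact k.2)
        (by rw [Fin.le_def]; rw [Fin.lt_def] at h1; simp only; omega)
        (by rw [Fin.lt_def]; rw [Fin.le_def] at h2; simp only; omega)]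
      congr 1
      apply Fin.ext
      simp only [hk]
    rw [this]
    exact hk
  have hre : (∑ a : Fin n, ∑ b : Fin n, if a < b then M (τ a) (τ b) else 0) =
      ∑ a : Fin n, ∑ b : Fin n, if p a < p b then M (σ a) (σ b) else 0 := by
    rw [← Equiv.sum_comp p]
    refine Finset.sum_congr rfl fun a _ => ?_
    rw [← Equiv.sum_comp p]
    simp only [hpτ]
  have hpt : ∀ a b : Fin n, ((if p a < p b then M (σ a) (σ b) else 0) -
      (if a < b then M (σ a) (σ b) else 0)) =
      (if b = i then (if a ∈ Finset.Ioc i j then M (σ a) (σ b) else 0) else 0) -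
      (if a = i then (if b ∈ Finset.Ioc i j then M (σ a) (σ b) else 0) else 0) := by
    have hcase : ∀ k : Fin n, (k = i ∧ (p k : ℕ) = j) ∨
        (((k : ℕ) < i ∨ (j : ℕ) < k) ∧ (p k : ℕ) = k) ∨
        ((i : ℕ) < k ∧ (k : ℕ) ≤ j ∧ (p k : ℕ) + 1 = k) := fun k => by
      rcases lt_trichotomy k i with h | h | h
      · exact Or.inr (Or.inl ⟨Or.inl h, by rw [hpout k (Or.inl h)]⟩)
      · exact Or.inl ⟨h, by rw [h, hpi]⟩
      · rcases le_or_gt k j with h' | h'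
        · exact Or.inr (Or.inr ⟨h, h', hpmid k h h'⟩)
        · exact Or.inr (Or.inl ⟨Or.inr h', by rw [hpout k (Or.inr h')]⟩)
    intro a b
    have ha := hcase a
    have hb := hcase b
    generalize M (σ a) (σ b) = x
    simp only [Finset.mem_Ioc, Fin.lt_def, Fin.le_def, Fin.ext_iff] at *
    split_ifs <;> first | (exfalso; omega) | simp
  rw [hre, ← Finset.sum_sub_distrib]
  simp only [← Finset.sum_sub_distrib, hpt]
  simp only [Finset.sum_sub_distrib, Finset.sum_ite_eq', Finset.mem_univ, if_true]
  rw [Finset.sum_comm (f := fun a b => if a = i then _ else _)]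
  simp only [Finset.sum_ite_eq', Finset.sum_ite_mem, Finset.mem_univ, if_true, Finset.univ_inter]
end

section
/- Let M = (m_{ij}) be an n×n real matrix, σ a permutation of {1,…,n}, and 1 ≤ i < j ≤ n. Let τ be the permutation obtained from σ by the backward insert move of the element at position j to position i, i.e. τ(k) = σ(k) for k < i or k > j, τ(i) = σ(j), and τ(k) = σ(k−1) for i < k ≤ j. Then the change in the LOP objective is f(τ) − f(σ) = Σ_{k=i}^{j−1} (m_{σ(j)σ(k)} − m_{σ(k)σ(j)}). -/
/-- Delta of a backward insert move: if τ is obtained from σ by moving the element at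
position j to position i < j (shifting the intermediate elements one place forward), then
f(τ) − f(σ) = Σ_{k=i}^{j−1} (m_{σ(j)σ(k)} − m_{σ(k)σ(j)}). -/
theorem lop_backward_insert_delta (n : ℕ) (M : Matrix (Fin n) (Fin n) ℝ)
    (σ τ : Equiv.Perm (Fin n)) (i j : Fin n) (hij : i < j)
    (houtside : ∀ k : Fin n, k < i ∨ j < k → τ k = σ k)
    (hfirst : τ i = σ j)
    (hshift : ∀ k : Fin n, i < k → k ≤ j →
      τ k = σ ⟨(k : ℕ) - 1, Nat.lt_of_le_of_lt (Nat.sub_le _ _) k.isLt⟩) :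
    (∑ a : Fin n, ∑ b : Fin n, if a < b then M (τ a) (τ b) else 0) -
      (∑ a : Fin n, ∑ b : Fin n, if a < b then M (σ a) (σ b) else 0) =
    ∑ k ∈ Finset.Ico i j, (M (σ j) (σ k) - M (σ k) (σ j)) := by
  -- `ρ` sends a position in `σ` to the position of the same element in `τ`
  have key : ∃ ρ : Equiv.Perm (Fin n), ∀ k, τ (ρ k) = σ k :=
    ⟨σ.trans τ.symm, fun k => by simp⟩
  obtain ⟨ρ, hρ⟩ := key
  have hout : ∀ k : Fin n, k < i ∨ j < k → ρ k = k := fun k hk =>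
    τ.injective (by rw [hρ, houtside k hk])
  have hj : ρ j = i := τ.injective (by rw [hρ, hfirst])
  have hmid : ∀ k : Fin n, i ≤ k → k < j → (ρ k : ℕ) = k + 1 := by
    intro k h1 h2
    have hlt : (k : ℕ) + 1 < n := by omega
    have : ρ k = ⟨k + 1, hlt⟩ := by
      apply τ.injective
      rw [hρ, hshift ⟨k + 1, hlt⟩ (by rw [Fin.lt_def]; simp only; omega)
        (by rw [Fin.le_def]; simp only; omega)]
      congr 1
    rw [this]
  have hcase : ∀ k : Fin n, ((k : ℕ) < i ∨ (j : ℕ) < k) ∧ (ρ k : ℕ) = k ∨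
      (k : ℕ) = j ∧ (ρ k : ℕ) = i ∨ ((i : ℕ) ≤ k ∧ (k : ℕ) < j) ∧ (ρ k : ℕ) = k + 1 := by
    intro k
    by_cases h1 : k < i ∨ j < k
    · left
      exact ⟨h1, by rw [hout k h1]⟩
    · right
      by_cases h2 : k = j
      · left
        exact ⟨by rw [h2], by rw [h2, hj]⟩
      · right
        have h3 : i ≤ k ∧ k < j := by
          constructor <;> omega
        exact ⟨h3, hmid k h3.1 h3.2⟩
  have hre : (∑ a : Fin n, ∑ b : Fin n, if a < b then M (τ a) (τ b) else 0) =
      ∑ a : Fin n, ∑ b : Fin n, if ρ a < ρ b then M (σ a) (σ b) else 0 := by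
    rw [← Equiv.sum_comp ρ]
    refine Finset.sum_congr rfl fun a _ => ?_
    rw [← Equiv.sum_comp ρ]
    simp only [hρ]
  have hterm : ∀ a b : Fin n, ((if ρ a < ρ b then M (σ a) (σ b) else 0) -
      (if a < b then M (σ a) (σ b) else 0)) =
      (if a = j then (if b ∈ Finset.Ico i j then M (σ a) (σ b) else 0) else 0) -
      (if b = j then (if a ∈ Finset.Ico i j then M (σ a) (σ b) else 0) else 0) := by
    intro a b
    have ha := hcase a
    have hb := hcase b
    simp only [Finset.mem_Ico, Fin.lt_def, Fin.le_def, Fin.ext_iff]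
    split_ifs <;> first | (exfalso; omega) | ring
  rw [hre, ← Finset.sum_sub_distrib]
  simp only [← Finset.sum_sub_distrib, hterm]
  simp only [Finset.sum_sub_distrib]
  congr 1
  · rw [Finset.sum_comm]
    simp [-Finset.mem_Ico]
  · simp [-Finset.mem_Ico]
end

section
/- For every n×n real matrix M = (m_{ij}) and every permutation σ of {1,…,n}, if for every position i and every forward or backward insert move of the element at position i the corresponding insert-move delta is nonpositive, then σ is a local optimum of the insert neighborhood: f(τ) ≤ f(σ) for every permutation τ in the insert neighborhood of σ. -/
theorem lop_reindex (n : ℕ) (M : Matrix (Fin n) (Fin n) ℝ) (σ τ : Equiv.Perm (Fin n)) :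
    (∑ a : Fin n, ∑ b : Fin n, if a < b then M (τ a) (τ b) else 0) =
      ∑ x : Fin n, ∑ y : Fin n,
        if τ.symm (σ x) < τ.symm (σ y) then M (σ x) (σ y) else 0 := by
  rw [← Equiv.sum_comp (σ.trans τ.symm)]
  refine Finset.sum_congr rfl fun x _ => ?_
  rw [← Equiv.sum_comp (σ.trans τ.symm)]
  simp

/-- Moving the element at position `c` past exactly the positions in `S`. -/
theorem lop_delta (n : ℕ) (A : Fin n → Fin n → ℝ) (P Q : Fin n → Fin n → Prop)
    [∀ x y, Decidable (P x y)] [∀ x y, Decidable (Q x y)] (c : Fin n) (S : Finset (Fin n))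
    (h : ∀ x y, (if P x y then A x y else 0) = (if Q x y then A x y else 0)
      + (if y = c then (if x ∈ S then A x y else 0) else 0)
      - (if x = c then (if y ∈ S then A x y else 0) else 0)) :
    (∑ x, ∑ y, if P x y then A x y else 0) = (∑ x, ∑ y, if Q x y then A x y else 0)
      + ∑ k ∈ S, (A k c - A c k) := by
  simp only [h, Finset.sum_add_distrib, Finset.sum_sub_distrib]
  have h2 : (∑ x, ∑ y, if x = c then (if y ∈ S then A x y else 0) else 0)
      = ∑ k ∈ S, A c k := by
    rw [Finset.sum_comm]
    simp
  rw [h2]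
  simp
  ring

/-- If every forward and backward insert-move delta is nonpositive, then σ is a local
optimum of the insert neighborhood: f(τ) ≤ f(σ) for every τ in the insert neighborhood. -/
theorem lop_insert_local_optimum (n : ℕ) (M : Matrix (Fin n) (Fin n) ℝ)
    (σ : Equiv.Perm (Fin n))
    (hfwd : ∀ i j : Fin n, i < j →
      (∑ k ∈ Finset.Ioc i j, (M (σ k) (σ i) - M (σ i) (σ k))) ≤ 0)
    (hbwd : ∀ i j : Fin n, i < j →
      (∑ k ∈ Finset.Ico i j, (M (σ j) (σ k) - M (σ k) (σ j))) ≤ 0)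
    (τ : Equiv.Perm (Fin n))
    (hτ : (∃ i j : Fin n, i < j ∧
            (∀ k : Fin n, k < i ∨ j < k → τ k = σ k) ∧
            (∀ (k : Fin n) (hk : (k : ℕ) + 1 < n), i ≤ k → k < j →
              τ k = σ ⟨(k : ℕ) + 1, hk⟩) ∧
            τ j = σ i) ∨
          (∃ i j : Fin n, i < j ∧
            (∀ k : Fin n, k < i ∨ j < k → τ k = σ k) ∧
            τ i = σ j ∧
            (∀ k : Fin n, i < k → k ≤ j →
              τ k = σ ⟨(k : ℕ) - 1, Nat.lt_of_le_of_lt (Nat.sub_le _ _) k.isLt⟩))) :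
    (∑ a : Fin n, ∑ b : Fin n, if a < b then M (τ a) (τ b) else 0) ≤
      ∑ a : Fin n, ∑ b : Fin n, if a < b then M (σ a) (σ b) else 0 := by
  rw [lop_reindex n M σ τ]
  rcases hτ with ⟨i, j, hij, h1, h2, h3⟩ | ⟨i, j, hij, h1, h3, h2⟩
  · have p1 : ∀ x, x < i ∨ j < x → τ.symm (σ x) = x := fun x hx => by
      rw [← h1 x hx]; simp
    have p3 : τ.symm (σ i) = j := by rw [← h3]; simp
    have p2 : ∀ x : Fin n, i < x → x ≤ j → (τ.symm (σ x) : ℕ) = x - 1 := fun x hx hx' => by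
      have := h2 ⟨(x : ℕ) - 1, by omega⟩ (by simp only; omega)
        (by simp only [Fin.le_def]; omega) (by simp only [Fin.lt_def]; omega)
      have e : (⟨(x : ℕ) - 1 + 1, by omega⟩ : Fin n) = x := by ext; simp only; omega
      simp only [e] at this
      rw [← this]; simp
    have key : ∀ x : Fin n, (x = i ∧ (τ.symm (σ x) : ℕ) = j) ∨
        ((x < i ∨ j < x) ∧ (τ.symm (σ x) : ℕ) = x) ∨
        ((i < x ∧ x ≤ j) ∧ (τ.symm (σ x) : ℕ) = x - 1) := fun x => by
      by_cases a : x = i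
      · left; subst a; exact ⟨rfl, by rw [p3]⟩
      · by_cases b : x < i ∨ j < x
        · right; left; exact ⟨b, by rw [p1 x b]⟩
        · right; right
          have : i < x ∧ x ≤ j := by omega
          exact ⟨this, p2 x this.1 this.2⟩
    rw [lop_delta n (fun x y => M (σ x) (σ y)) (fun x y => τ.symm (σ x) < τ.symm (σ y))
      (fun x y => x < y) i (Finset.Ioc i j)]
    · linarith [hfwd i j hij]
    · intro x y
      have kx := key x
      have ky := key y
      simp only [Finset.mem_Ioc, Fin.lt_def, Fin.le_def, Fin.ext_iff] at *
      generalize (τ.symm (σ x) : ℕ) = px at *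
      generalize (τ.symm (σ y) : ℕ) = py at *
      clear h1 h2 h3 p1 p2 p3 key hfwd hbwd
      split_ifs <;> first | omega | simp
  · have p1 : ∀ x, x < i ∨ j < x → τ.symm (σ x) = x := fun x hx => by
      rw [← h1 x hx]; simp
    have p3 : τ.symm (σ j) = i := by rw [← h3]; simp
    have p2 : ∀ x : Fin n, i ≤ x → x < j → (τ.symm (σ x) : ℕ) = x + 1 := fun x hx hx' => by
      have := h2 ⟨(x : ℕ) + 1, by omega⟩
        (by simp only [Fin.lt_def]; omega) (by simp only [Fin.le_def]; omega)
      simp only [Nat.add_sub_cancel] at this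
      rw [← this]; simp
    have key : ∀ x : Fin n, (x = j ∧ (τ.symm (σ x) : ℕ) = i) ∨
        ((x < i ∨ j < x) ∧ (τ.symm (σ x) : ℕ) = x) ∨
        ((i ≤ x ∧ x < j) ∧ (τ.symm (σ x) : ℕ) = x + 1) := fun x => by
      by_cases a : x = j
      · left; subst a; exact ⟨rfl, by rw [p3]⟩
      · by_cases b : x < i ∨ j < x
        · right; left; exact ⟨b, by rw [p1 x b]⟩
        · right; right
          have : i ≤ x ∧ x < j := by omega
          exact ⟨this, p2 x this.1 this.2⟩
    have hb := hbwd i j hij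
    have d := lop_delta n (fun x y => M (σ x) (σ y)) (fun x y => x < y)
      (fun x y => τ.symm (σ x) < τ.symm (σ y)) j (Finset.Ico i j) (by
        intro x y
        have kx := key x
        have ky := key y
        simp only [Finset.mem_Ico, Fin.lt_def, Fin.le_def, Fin.ext_iff] at *
        generalize (τ.symm (σ x) : ℕ) = px at *
        generalize (τ.symm (σ y) : ℕ) = py at *
        clear h1 h2 h3 p1 p2 p3 key hfwd hbwd hb
        split_ifs <;> first | omega | simp)
    rw [Finset.sum_sub_distrib] at d hb
    linarith
end
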